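/- Let λ ∈ {1,2} and m ∈ {2,3}. Then every natural number n can be written as n = x^2 + y^2 + z^2 + w^2 where x, y, z, w are rational numbers with 7x, 7y, 7z, 7w all integers, such that x + 3y + 5z = λ·r^m for some nonnegative integer r. -/

import Mathlib

theorem exists_two_mul_sub_le {a : ℤ} (ha : 0 < a) (h : ℤ) :
    ∃ t : ℤ, -a ≤ 2 * (h - a * t) ∧ 2 * (h - a * t) ≤ a := by
  refine ⟨(2 * h + a) / (2 * a), ?_, ?_⟩
  · have := Int.mul_ediv_self_le (x := 2 * h + a) (k := 2 * a) (by positivity)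
    linarith
  · have := Int.lt_mul_ediv_self_add (x := 2 * h + a) (k := 2 * a) (by positivity)
    linarith

/-- A positive definite integral binary quadratic form of determinant `D` properly represents
a positive value `t` with `3 * t ^ 2 ≤ 4 * D`. -/
theorem exists_reduced_binary {D : ℤ} (hD : 0 < D) : ∀ (N : ℕ) (A B C : ℤ), A.toNat ≤ N → 0 < A →
    A * C - B ^ 2 = D → ∃ p q r s : ℤ, p * s - q * r = 1 ∧
      0 < A * p ^ 2 + 2 * B * p * r + C * r ^ 2 ∧
      3 * (A * p ^ 2 + 2 * B * p * r + C * r ^ 2) ^ 2 ≤ 4 * D := by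
  intro N
  induction N with
  | zero => intro A B C hN hA; omega
  | succ N ih =>
    intro A B C hN hA hdet
    obtain ⟨t, ht1, ht2⟩ := exists_two_mul_sub_le hA B
    obtain ⟨B', hB'⟩ : ∃ B', B' = B - A * t := ⟨_, rfl⟩
    obtain ⟨C', hC'⟩ : ∃ C', C' = C - 2 * B * t + A * t ^ 2 := ⟨_, rfl⟩
    rw [← hB'] at ht1 ht2
    have hdet' : A * C' - B' ^ 2 = D := by rw [hB', hC', ← hdet]; ring
    have hBsq : 4 * B' ^ 2 ≤ A ^ 2 := by nlinarith
    have hC0 : 0 < C' := by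
      by_contra! hcon
      nlinarith [sq_nonneg B']
    by_cases hlt : C' < A
    · obtain ⟨p, q, r, s, h1, h2, h3⟩ := ih C' B' A (by omega) hC0 (by linarith)
      have e : A * (r - t * p) ^ 2 + 2 * B * (r - t * p) * p + C * p ^ 2 =
          C' * p ^ 2 + 2 * B' * p * r + A * r ^ 2 := by rw [hB', hC']; ring
      refine ⟨r - t * p, -(s - t * q), p, -q, by linear_combination h1, ?_, ?_⟩ <;> rw [e]
      · exact h2
      · exact h3
    · refine ⟨1, 0, 0, 1, by ring, by simpa using hA, ?_⟩
      nlinarith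

/-- A value of a positive definite integral ternary quadratic form of determinant one is a sum of
three squares. -/
theorem ternary_det_one_sum_three_squares : ∀ (N : ℕ) (a b c h g k : ℤ), a.toNat ≤ N → 0 < a →
    0 < a * b - h ^ 2 →
    a * b * c + 2 * h * g * k - a * k ^ 2 - b * g ^ 2 - c * h ^ 2 = 1 →
    ∀ x y z : ℤ, ∃ u v w : ℤ,
      a * x ^ 2 + b * y ^ 2 + c * z ^ 2 + 2 * h * x * y + 2 * g * x * z + 2 * k * y * z =
        u ^ 2 + v ^ 2 + w ^ 2 := by
  intro N
  induction N with
  | zero => intro a b c h g k hN ha; omega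
  | succ N ih =>
    intro a b c h g k hN ha hA hdet x y z
    obtain ⟨p, q, r, s, hps, hpos, hle⟩ := exists_reduced_binary ha _ (a * b - h ^ 2)
      (a * k - g * h) (a * c - g ^ 2) le_rfl hA (by linear_combination a * hdet)
    obtain ⟨t, ht⟩ : ∃ t, t = (a * b - h ^ 2) * p ^ 2 + 2 * (a * k - g * h) * p * r +
      (a * c - g ^ 2) * r ^ 2 := ⟨_, rfl⟩
    rw [← ht] at hpos hle
    obtain ⟨τ, hτ1, hτ2⟩ := exists_two_mul_sub_le ha (h * p + g * r)
    obtain ⟨h', hh'⟩ : ∃ h', h' = h * p + g * r - a * τ := ⟨_, rfl⟩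
    rw [← hh'] at hτ1 hτ2
    obtain ⟨g', hg'⟩ : ∃ g', g' = h * q + g * s := ⟨_, rfl⟩
    obtain ⟨b', hb'⟩ : ∃ b', b' = b * p ^ 2 + 2 * k * p * r + c * r ^ 2 -
      2 * τ * (h * p + g * r) + a * τ ^ 2 := ⟨_, rfl⟩
    obtain ⟨c', hc'⟩ : ∃ c', c' = b * q ^ 2 + 2 * k * q * s + c * s ^ 2 := ⟨_, rfl⟩
    obtain ⟨k', hk'⟩ : ∃ k', k' = b * p * q + k * (p * s + q * r) + c * r * s - τ * g' := ⟨_, rfl⟩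
    have hab : a * b' - h' ^ 2 = t := by rw [hb', hh', ht]; ring
    have hdet' : a * b' * c' + 2 * h' * g' * k' - a * k' ^ 2 - b' * g' ^ 2 - c' * h' ^ 2 = 1 := by
      have e : a * b' * c' + 2 * h' * g' * k' - a * k' ^ 2 - b' * g' ^ 2 - c' * h' ^ 2 =
          (a * b * c + 2 * h * g * k - a * k ^ 2 - b * g ^ 2 - c * h ^ 2) *
            (p * s - q * r) ^ 2 := by
        rw [hk', hb', hc', hh', hg']; ring
      rw [e, hdet, hps]; norm_num
    have hb0 : 0 < b' := pos_of_mul_pos_right (by linarith [sq_nonneg h']) ha.le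
    have hhsq : (2 * h') ^ 2 ≤ a ^ 2 := sq_le_sq' hτ1 hτ2
    obtain ⟨y', hy'⟩ : ∃ y', y' = s * y - q * z := ⟨_, rfl⟩
    obtain ⟨z', hz'⟩ : ∃ z', z' = p * z - r * y := ⟨_, rfl⟩
    obtain ⟨x', hx'⟩ : ∃ x', x' = x + τ * y' := ⟨_, rfl⟩
    have hxx : x = x' - τ * y' := by rw [hx']; ring
    have hyy : y = p * y' + q * z' := by rw [hy', hz']; linear_combination (-y) * hps
    have hzz : z = r * y' + s * z' := by rw [hy', hz']; linear_combination (-z) * hps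
    have hval : a * x ^ 2 + b * y ^ 2 + c * z ^ 2 + 2 * h * x * y + 2 * g * x * z + 2 * k * y * z =
        a * x' ^ 2 + b' * y' ^ 2 + c' * z' ^ 2 + 2 * h' * x' * y' + 2 * g' * x' * z' +
          2 * k' * y' * z' := by
      clear hx' hy' hz'
      rw [hxx, hyy, hzz, hk', hb', hc', hh', hg']; ring
    rw [hval]
    by_cases hlt : b' < a
    · obtain ⟨u, v, w, e⟩ := ih b' a c' h' k' g' (by omega) hb0 (by linarith)
        (by linear_combination hdet') y' x' z'
      exact ⟨u, v, w, by linear_combination e⟩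
    · have h3 : 3 * a ^ 2 ≤ 4 * t := by
        have := mul_le_mul_of_nonneg_left (not_lt.1 hlt) ha.le
        linarith
      have h4 : (3 * a ^ 2) ^ 2 ≤ (4 * t) ^ 2 := pow_le_pow_left₀ (by positivity) h3 2
      have ha1 : a = 1 := by
        by_contra hne
        have h2 : 2 ≤ a := by omega
        have h5 : 27 * a ^ 3 ≤ 64 := by
          refine le_of_mul_le_mul_left ?_ ha
          linarith
        have h6 : 2 ^ 3 ≤ a ^ 3 := by gcongr
        linarith
      subst ha1
      have hh0 : h' = 0 := by omega
      subst hh0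
      have hbt : b' = t := by linarith
      have hb1 : b' = 1 := by
        rw [hbt]
        by_contra hne
        have h2 : 2 ≤ t := by omega
        have h5 : 2 ^ 2 ≤ t ^ 2 := by gcongr
        linarith
      clear hbt hb' hval hab hlt
      subst hb1
      exact ⟨x' + g' * z', y' + k' * z', z', by linear_combination z' ^ 2 * hdet'⟩

theorem sum_three_squares_of_dvd (n d b h : ℤ) (hd : 0 < d) (hb : 0 < b) (hbd : b = d * n - 1)
    (hdvd : b ∣ h ^ 2 + d) : ∃ u v w : ℤ, n = u ^ 2 + v ^ 2 + w ^ 2 := by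
  obtain ⟨a, ha⟩ := hdvd
  have ha0 : 0 < a := by
    by_contra! hcon
    nlinarith [sq_nonneg h]
  obtain ⟨u, v, w, e⟩ := ternary_det_one_sum_three_squares a.toNat a b n h 1 0 le_rfl ha0
    (by linarith) (by linear_combination (-n) * ha - hbd) 0 0 1
  exact ⟨u, v, w, by linarith⟩

theorem exists_dvd_sq_add_of_jacobiSym {p : ℕ} (hp : p.Prime) {d : ℕ}
    (h : jacobiSym (-d) p = 1) : ∃ x : ℤ, (p : ℤ) ∣ x ^ 2 + d := by
  have := Fact.mk hp
  rw [← jacobiSym.legendreSym.to_jacobiSym] at h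
  have h0 : ((-d : ℤ) : ZMod p) ≠ 0 := by
    intro h0
    rw [(legendreSym.eq_zero_iff p _).2 h0] at h
    exact zero_ne_one h
  obtain ⟨y, hy⟩ := (legendreSym.eq_one_iff p h0).1 h
  obtain ⟨x, rfl⟩ := ZMod.intCast_surjective y
  refine ⟨x, (ZMod.intCast_zmod_eq_zero_iff_dvd _ p).1 ?_⟩
  push_cast at hy ⊢
  linear_combination -hy

theorem jacobiSym_neg_eq {d p : ℕ} (hd : Odd d) (hp : Odd p) (h : p % 4 = 1 ∨ d % 4 = 3) :
    jacobiSym (-d) p = jacobiSym p d := by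
  rw [← neg_one_mul, jacobiSym.mul_left, jacobiSym.at_neg_one hp]
  rcases Nat.odd_mod_four_iff.1 (Nat.odd_iff.1 hp) with hp4 | hp4
  · rw [ZMod.χ₄_nat_one_mod_four hp4, one_mul,
      jacobiSym.quadratic_reciprocity_one_mod_four' hd hp4]
  · rw [ZMod.χ₄_nat_three_mod_four hp4,
      jacobiSym.quadratic_reciprocity_three_mod_four (h.resolve_left (by omega)) hp4]
    ring

theorem sum_three_squares_of_mod_four_eq_two {n : ℕ} (hn : n % 4 = 2) :
    ∃ u v w : ℤ, (n : ℤ) = u ^ 2 + v ^ 2 + w ^ 2 := by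
  have : NeZero (4 * n) := ⟨by omega⟩
  have hc : Nat.Coprime (n - 1) (4 * n) := by
    refine Nat.Coprime.mul_right ?_ ?_
    · have : Nat.Coprime (n - 1) 2 := by
        rw [Nat.coprime_comm, Nat.coprime_two_left, Nat.odd_iff]; omega
      exact this.pow_right 2
    · exact (Nat.coprime_self_sub_left (by omega)).2 (by simp)
  obtain ⟨p, hpn, hp, hpe⟩ := Nat.forall_exists_prime_gt_and_eq_mod
    ((ZMod.isUnit_iff_coprime (n - 1) (4 * n)).2 hc) n
  rw [ZMod.natCast_eq_natCast_iff, Nat.ModEq.comm, Nat.modEq_iff_dvd' (by omega)] at hpe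
  obtain ⟨v, hv⟩ := hpe
  have hpd : p + 1 = (4 * v + 1) * n := by
    have : (4 * v + 1) * n = 4 * n * v + n := by ring
    omega
  have hp4 : p % 4 = 1 := by
    have : 4 * n * v = 4 * (n * v) := by ring
    omega
  have hpdz : (p : ℤ) + 1 = (4 * v + 1) * n := by exact_mod_cast hpd
  obtain ⟨h, hh⟩ := exists_dvd_sq_add_of_jacobiSym hp (d := 4 * v + 1) (by
    have hd : Odd (4 * v + 1) := by rw [Nat.odd_iff]; omega
    rw [jacobiSym_neg_eq hd (by rw [Nat.odd_iff]; omega) (Or.inl hp4),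
      jacobiSym.mod_left' (a₂ := -1), jacobiSym.at_neg_one hd, ZMod.χ₄_nat_one_mod_four (by omega)]
    refine Int.ModEq.symm (Int.modEq_iff_dvd.2 ⟨n, ?_⟩)
    push_cast
    linarith)
  refine sum_three_squares_of_dvd n (4 * v + 1) p h (by positivity)
    (by exact_mod_cast hp.pos) (by linarith) (by exact_mod_cast hh)

theorem sum_three_squares_of_two_mul_add_one_eq {n c q : ℕ} (hq : 2 * q + 1 = c * n) (hq2 : Odd q)
    (hc : c % 2 = 1) (h4 : q % 4 = 1 ∨ c % 4 = 3) (hc8 : c % 8 = 1 ∨ c % 8 = 3) :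
    ∃ u v w : ℤ, (n : ℤ) = u ^ 2 + v ^ 2 + w ^ 2 := by
  have hn0 : n ≠ 0 := by rintro rfl; omega
  have : NeZero (4 * n) := ⟨by omega⟩
  have hcop : Nat.Coprime q (4 * n) := by
    refine Nat.Coprime.mul_right ?_ ?_
    · exact (Nat.coprime_two_right.2 hq2).pow_right 2
    · refine Nat.Coprime.coprime_mul_left_right (k := c) ?_
      rw [← hq]
      simp
  obtain ⟨p, hpn, hp, hpe⟩ := Nat.forall_exists_prime_gt_and_eq_mod
    ((ZMod.isUnit_iff_coprime q (4 * n)).2 hcop) q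
  rw [ZMod.natCast_eq_natCast_iff, Nat.ModEq.comm, Nat.modEq_iff_dvd' (by omega)] at hpe
  obtain ⟨v, hv⟩ := hpe
  have hpd : 2 * p + 1 = (8 * v + c) * n := by
    have : (8 * v + c) * n = 2 * (4 * n * v) + c * n := by ring
    omega
  have hp4 : p % 4 = q % 4 := by
    have : 4 * n * v = 4 * (n * v) := by ring
    omega
  have hpodd : Odd p := by rw [Nat.odd_iff] at hq2 ⊢; omega
  have hpdz : 2 * (p : ℤ) + 1 = (8 * v + c) * n := by exact_mod_cast hpd
  have hd : Odd (8 * v + c) := by rw [Nat.odd_iff]; omega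
  have hJ : jacobiSym 2 (8 * v + c) * jacobiSym p (8 * v + c) = jacobiSym (-1) (8 * v + c) := by
    rw [← jacobiSym.mul_left]
    refine jacobiSym.mod_left' (Int.ModEq.symm (Int.modEq_iff_dvd.2 ⟨n, ?_⟩))
    push_cast
    linarith
  obtain ⟨h, hh⟩ := exists_dvd_sq_add_of_jacobiSym hp (d := 8 * v + c) (by
    rw [jacobiSym_neg_eq hd hpodd (by omega)]
    rw [jacobiSym.at_two hd, jacobiSym.at_neg_one hd, ZMod.χ₈_nat_eq_if_mod_eight,
      ZMod.χ₄_nat_eq_if_mod_four] at hJ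
    have e2 : (8 * v + c) % 2 = 1 := by omega
    rcases hc8 with h8 | h8
    · have e8 : (8 * v + c) % 8 = 1 := by omega
      have e4 : (8 * v + c) % 4 = 1 := by omega
      simpa [e8, e4, e2] using hJ
    · have e8 : (8 * v + c) % 8 = 3 := by omega
      have e4 : (8 * v + c) % 4 = 3 := by omega
      simpa [e8, e4, e2] using hJ)
  push_cast at hh
  obtain ⟨h', hodd, hh'⟩ : ∃ h' : ℤ, Odd h' ∧ (p : ℤ) ∣ h' ^ 2 + (8 * v + c) := by
    rcases Int.even_or_odd h with he | ho
    · refine ⟨h + p, he.add_odd (by exact_mod_cast hpodd), ?_⟩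
      have e : (h + p) ^ 2 + (8 * v + c : ℤ) = h ^ 2 + (8 * v + c) + p * (2 * h + p) := by ring
      rw [e]
      exact dvd_add hh (dvd_mul_right _ _)
    · exact ⟨h, ho, hh⟩
  refine sum_three_squares_of_dvd n (8 * v + c) (2 * p) h' (by exact_mod_cast hd.pos)
    (by have := hp.pos; positivity) (by linarith) (IsCoprime.mul_dvd ?_ ?_ hh')
  · rw [← Nat.cast_two, Nat.isCoprime_iff_coprime]
    exact Nat.coprime_two_left.2 hpodd
  · exact (hodd.pow.add_odd (by exact_mod_cast hd)).two_dvd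

theorem sum_three_squares_of_odd {n : ℕ} (hn : n % 8 = 1 ∨ n % 8 = 3 ∨ n % 8 = 5) :
    ∃ u v w : ℤ, (n : ℤ) = u ^ 2 + v ^ 2 + w ^ 2 := by
  by_cases h3 : n % 8 = 3
  · exact sum_three_squares_of_two_mul_add_one_eq (c := 1) (q := (n - 1) / 2) (by omega)
      (by rw [Nat.odd_iff]; omega) (by omega) (by omega) (by omega)
  · exact sum_three_squares_of_two_mul_add_one_eq (c := 3) (q := (3 * n - 1) / 2) (by omega)
      (by rw [Nat.odd_iff]; omega) (by omega) (by omega) (by omega)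

theorem sum_three_squares {n : ℕ}
    (hn : n % 8 = 1 ∨ n % 8 = 2 ∨ n % 8 = 3 ∨ n % 8 = 5 ∨ n % 8 = 6) :
    ∃ u v w : ℤ, (n : ℤ) = u ^ 2 + v ^ 2 + w ^ 2 := by
  rcases Nat.even_or_odd n with he | ho
  · exact sum_three_squares_of_mod_four_eq_two (by rw [Nat.even_iff] at he; omega)
  · exact sum_three_squares_of_odd (by rw [Nat.odd_iff] at ho; omega)

/-- `n` is a sum of four squares of elements `x, y, z, w` of `ℤ/7` with `x + 3y + 5z = s`. -/
def HasRep (n s : ℤ) : Prop :=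
  ∃ x y z w : ℤ, 49 * n = x ^ 2 + y ^ 2 + z ^ 2 + w ^ 2 ∧ x + 3 * y + 5 * z = 7 * s

theorem hasRep_of_one_three_five {n s x y z w : ℤ} (hn : n = x ^ 2 + y ^ 2 + z ^ 2 + w ^ 2)
    (hs : x + 3 * y + 5 * z = s) : HasRep n s :=
  ⟨7 * x, 7 * y, 7 * z, 7 * w, by rw [hn]; ring, by rw [← hs]; ring⟩

theorem hasRep_of_neg_one_three_four_three {n s x y z w : ℤ}
    (hn : n = x ^ 2 + y ^ 2 + z ^ 2 + w ^ 2) (hs : -x + 3 * y + 4 * z + 3 * w = s) :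
    HasRep n s :=
  ⟨7 * x - 2 * (2 * x + z - 3 * w), 7 * y, 7 * z - (2 * x + z - 3 * w),
    7 * w + 3 * (2 * x + z - 3 * w), by rw [hn]; ring, by rw [← hs]; ring⟩

theorem exists_dvd_of_seven_dvd {a b c d : ℤ} (h : 7 ∣ a ^ 2 + b ^ 2 + c ^ 2 + d ^ 2) :
    ∃ e f g : ℤ, (e = 1 ∨ e = -1) ∧ (f = 1 ∨ f = -1) ∧ (g = 1 ∨ g = -1) ∧
      7 ∣ 2 * a + e * b + f * c + g * d ∧ 7 ∣ 2 * b - e * a - f * d + g * c ∧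
      7 ∣ 2 * c - f * a + e * d - g * b ∧ 7 ∣ 2 * d - g * a - e * c + f * b := by
  have key : ∀ a b c d : ZMod 7, a ^ 2 + b ^ 2 + c ^ 2 + d ^ 2 = 0 →
      ∃ e ∈ ([1, -1] : List ℤ), ∃ f ∈ ([1, -1] : List ℤ), ∃ g ∈ ([1, -1] : List ℤ),
        2 * a + e * b + f * c + g * d = 0 ∧ 2 * b - e * a - f * d + g * c = 0 ∧
        2 * c - f * a + e * d - g * b = 0 ∧ 2 * d - g * a - e * c + f * b = 0 := by
    decide +kernel
  obtain ⟨e, he, f, hf, g, hg, h1, h2, h3, h4⟩ := key a b c d (by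
    have := (ZMod.intCast_zmod_eq_zero_iff_dvd _ 7).2 h
    exact_mod_cast this)
  refine ⟨e, f, g, by simpa using he, by simpa using hf, by simpa using hg, ?_⟩
  simp only [← Nat.cast_ofNat (n := 7) (R := ℤ), ← ZMod.intCast_zmod_eq_zero_iff_dvd]
  push_cast
  exact ⟨h1, h2, h3, h4⟩

theorem hasRep_of_seven_mul {n a b c d : ℤ} (h : 7 * n = a ^ 2 + b ^ 2 + c ^ 2 + d ^ 2) :
    HasRep n (a - 2 * b) := by
  obtain ⟨e, f, g, he, hf, hg, ⟨x, hx⟩, ⟨y, hy⟩, ⟨z, hz⟩, ⟨w, hw⟩⟩ :=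
    exists_dvd_of_seven_dvd (Dvd.intro _ h)
  have hn : n = x ^ 2 + y ^ 2 + z ^ 2 + w ^ 2 := by
    have h1 : 49 * (x ^ 2 + y ^ 2 + z ^ 2 + w ^ 2) =
        (7 * x) ^ 2 + (7 * y) ^ 2 + (7 * z) ^ 2 + (7 * w) ^ 2 := by ring
    have h2 : (7 * x) ^ 2 + (7 * y) ^ 2 + (7 * z) ^ 2 + (7 * w) ^ 2 =
        7 * (a ^ 2 + b ^ 2 + c ^ 2 + d ^ 2) := by
      rw [← hx, ← hy, ← hz, ← hw]
      rcases he with rfl | rfl <;> rcases hf with rfl | rfl <;> rcases hg with rfl | rfl <;> ring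
    linarith
  rcases he with rfl | rfl <;> rcases hf with rfl | rfl <;> rcases hg with rfl | rfl
  · exact hasRep_of_one_three_five (x := z) (y := -w) (z := -y) (w := x)
      (by linear_combination hn) (by linarith)
  · exact hasRep_of_one_three_five (x := -w) (y := -z) (z := -y) (w := x)
      (by linear_combination hn) (by linarith)
  · exact hasRep_of_one_three_five (x := w) (y := z) (z := -y) (w := x)
      (by linear_combination hn) (by linarith)
  · exact hasRep_of_one_three_five (x := -z) (y := w) (z := -y) (w := x)
      (by linear_combination hn) (by linarith)
  · exact hasRep_of_neg_one_three_four_three (x := -z) (y := -y) (z := x) (w := -w)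
      (by linear_combination hn) (by linarith)
  · exact hasRep_of_neg_one_three_four_three (x := w) (y := -y) (z := x) (w := -z)
      (by linear_combination hn) (by linarith)
  · exact hasRep_of_neg_one_three_four_three (x := -w) (y := -y) (z := x) (w := z)
      (by linear_combination hn) (by linarith)
  · exact hasRep_of_neg_one_three_four_three (x := z) (y := -y) (z := x) (w := w)
      (by linear_combination hn) (by linarith)

theorem exists_dvd_of_five_dvd {s a b c : ℤ} (h : 5 ∣ s ^ 2 + a ^ 2 + b ^ 2 + c ^ 2) :
    ∃ x y z : ℤ, x ^ 2 + y ^ 2 + z ^ 2 = a ^ 2 + b ^ 2 + c ^ 2 ∧ 5 ∣ x - 2 * s ∧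
      5 ∣ z - 2 * y := by
  have key : ∀ s a b c : ZMod 5, s ^ 2 + a ^ 2 + b ^ 2 + c ^ 2 = 0 →
      ∃ e ∈ ([1, -1] : List ℤ), ∃ f ∈ ([1, -1] : List ℤ),
        (e * a - 2 * s = 0 ∧ c - 2 * (f * b) = 0) ∨ (e * b - 2 * s = 0 ∧ c - 2 * (f * a) = 0) ∨
        (e * c - 2 * s = 0 ∧ b - 2 * (f * a) = 0) ∨ (e * a - 2 * s = 0 ∧ b - 2 * (f * c) = 0) ∨
        (e * b - 2 * s = 0 ∧ a - 2 * (f * c) = 0) ∨ (e * c - 2 * s = 0 ∧ a - 2 * (f * b) = 0) := by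
    decide +kernel
  obtain ⟨e, he, f, hf, h1⟩ := key s a b c (by
    have := (ZMod.intCast_zmod_eq_zero_iff_dvd _ 5).2 h
    exact_mod_cast this)
  have he2 : e ^ 2 = 1 := by
    rcases (by simpa using he : e = 1 ∨ e = -1) with rfl | rfl <;> norm_num
  have hf2 : f ^ 2 = 1 := by
    rcases (by simpa using hf : f = 1 ∨ f = -1) with rfl | rfl <;> norm_num
  rcases h1 with h1 | h1 | h1 | h1 | h1 | h1
  · refine ⟨e * a, f * b, c, by rw [mul_pow, mul_pow, he2, hf2]; ring, ?_⟩
    simp only [← Nat.cast_ofNat (n := 5) (R := ℤ), ← ZMod.intCast_zmod_eq_zero_iff_dvd]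
    push_cast
    exact h1
  · refine ⟨e * b, f * a, c, by rw [mul_pow, mul_pow, he2, hf2]; ring, ?_⟩
    simp only [← Nat.cast_ofNat (n := 5) (R := ℤ), ← ZMod.intCast_zmod_eq_zero_iff_dvd]
    push_cast
    exact h1
  · refine ⟨e * c, f * a, b, by rw [mul_pow, mul_pow, he2, hf2]; ring, ?_⟩
    simp only [← Nat.cast_ofNat (n := 5) (R := ℤ), ← ZMod.intCast_zmod_eq_zero_iff_dvd]
    push_cast
    exact h1
  · refine ⟨e * a, f * c, b, by rw [mul_pow, mul_pow, he2, hf2]; ring, ?_⟩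
    simp only [← Nat.cast_ofNat (n := 5) (R := ℤ), ← ZMod.intCast_zmod_eq_zero_iff_dvd]
    push_cast
    exact h1
  · refine ⟨e * b, f * c, a, by rw [mul_pow, mul_pow, he2, hf2]; ring, ?_⟩
    simp only [← Nat.cast_ofNat (n := 5) (R := ℤ), ← ZMod.intCast_zmod_eq_zero_iff_dvd]
    push_cast
    exact h1
  · refine ⟨e * c, f * b, a, by rw [mul_pow, mul_pow, he2, hf2]; ring, ?_⟩
    simp only [← Nat.cast_ofNat (n := 5) (R := ℤ), ← ZMod.intCast_zmod_eq_zero_iff_dvd]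
    push_cast
    exact h1

theorem hasRep_of_three_squares {n s a b c : ℤ} (h : 35 * n = s ^ 2 + (a ^ 2 + b ^ 2 + c ^ 2)) :
    HasRep n s := by
  obtain ⟨x, y, z, h1, ⟨u, hu⟩, ⟨v, hv⟩⟩ :=
    exists_dvd_of_five_dvd (s := s) (a := a) (b := b) (c := c) ⟨7 * n, by linarith⟩
  obtain rfl : x = 2 * s + 5 * u := by linarith
  obtain rfl : z = 2 * y + 5 * v := by linarith
  have := hasRep_of_seven_mul (n := n) (a := s + 2 * u) (b := u) (c := y + 2 * v) (d := v)
    (by linarith)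
  rwa [add_sub_cancel_right] at this

theorem hasRep_of_mod_eight {n s N : ℕ} (h : 35 * n = s ^ 2 + N)
    (hN : N % 8 = 1 ∨ N % 8 = 2 ∨ N % 8 = 3 ∨ N % 8 = 5 ∨ N % 8 = 6) : HasRep n s := by
  obtain ⟨a, b, c, e⟩ := sum_three_squares hN
  exact hasRep_of_three_squares (a := a) (b := b) (c := c) (by rw [← e]; exact_mod_cast h)

theorem HasRep.scale {n s : ℤ} (h : HasRep n s) (t : ℤ) : HasRep (t ^ 2 * n) (t * s) := by
  obtain ⟨x, y, z, w, h1, h2⟩ := h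
  exact ⟨t * x, t * y, t * z, t * w, by linear_combination t ^ 2 * h1, by linear_combination t * h2⟩

theorem hasRep_zero_or {n : ℕ} (h : n % 4 ≠ 0) :
    HasRep n 0 ∨ HasRep n 1 ∧ HasRep n 2 ∧ HasRep (4 * n) 1 := by
  by_cases h5 : n % 8 = 5
  · right
    refine ⟨?_, ?_, ?_⟩
    · exact_mod_cast hasRep_of_mod_eight (n := n) (s := 1) (N := 35 * n - 1) (by omega) (by omega)
    · exact_mod_cast hasRep_of_mod_eight (n := n) (s := 2) (N := 35 * n - 4) (by omega) (by omega)
    · exact_mod_cast hasRep_of_mod_eight (n := 4 * n) (s := 1) (N := 140 * n - 1)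
        (by omega) (by omega)
  · left
    exact_mod_cast hasRep_of_mod_eight (n := n) (s := 0) (N := 35 * n) (by omega) (by omega)

theorem exists_hasRep {l : ℤ} (hl : l = 1 ∨ l = 2) {m : ℕ} (hm : m = 2 ∨ m = 3) (n : ℕ) :
    ∃ r : ℕ, HasRep n (l * r ^ m) := by
  have hm0 : m ≠ 0 := by omega
  induction n using Nat.strong_induction_on with
  | _ n ih =>
    rcases Nat.eq_zero_or_pos n with rfl | hn
    · exact ⟨0, 0, 0, 0, 0, by simp, by simp [hm0]⟩
    by_cases hdvd : 4 ^ m ∣ n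
    · obtain ⟨k, rfl⟩ := hdvd
      obtain ⟨r, hr⟩ := ih k ((Nat.lt_mul_iff_one_lt_left (Nat.pos_of_mul_pos_left hn)).2
        (Nat.one_lt_pow hm0 (by norm_num)))
      refine ⟨2 * r, ?_⟩
      convert hr.scale (2 ^ m) using 1
      · push_cast
        rw [← pow_mul, mul_comm m 2, pow_mul]
        norm_num
      · push_cast
        ring
    have hzero : ∀ {k : ℤ}, HasRep k 0 → ∃ r : ℕ, HasRep k (l * r ^ m) := fun h =>
      ⟨0, by simpa [hm0] using h⟩
    have hone : ∀ {k : ℤ}, HasRep k l → ∃ r : ℕ, HasRep k (l * r ^ m) := fun h =>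
      ⟨1, by simpa using h⟩
    by_cases h4 : n % 4 = 0
    · obtain ⟨k, rfl⟩ := Nat.dvd_of_mod_eq_zero h4
      push_cast
      by_cases hk : k % 4 = 0
      · obtain ⟨j, rfl⟩ := Nat.dvd_of_mod_eq_zero hk
        obtain rfl : m = 3 := hm.resolve_left (by rintro rfl; omega)
        push_cast
        rcases hasRep_zero_or (n := j) (by omega) with h0 | ⟨h1, h2, h3⟩
        · apply hzero
          convert h0.scale 4 using 1 <;> ring
        · rcases hl with rfl | rfl
          · refine ⟨2, ?_⟩
            convert h2.scale 4 using 1 <;> ring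
          · apply hone
            convert h3.scale 2 using 1 <;> ring
      · rcases hasRep_zero_or hk with h0 | ⟨h1, h2, h3⟩
        · apply hzero
          convert h0.scale 2 using 1 <;> ring
        · rcases hl with rfl | rfl
          · exact hone h3
          · apply hone
            convert h1.scale 2 using 1 <;> ring
    · rcases hasRep_zero_or h4 with h0 | ⟨h1, h2, h3⟩
      · exact hzero h0
      · rcases hl with rfl | rfl
        · exact hone h1
        · exact hone h2

theorem stmt_19 (l : ℤ) (hl : l = 1 ∨ l = 2) (m : ℕ) (hm : m = 2 ∨ m = 3) (n : ℕ) :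
    ∃ x y z w : ℚ, (n : ℚ) = x ^ 2 + y ^ 2 + z ^ 2 + w ^ 2 ∧
      (∃ X : ℤ, 7 * x = (X : ℚ)) ∧ (∃ Y : ℤ, 7 * y = (Y : ℚ)) ∧
      (∃ Z : ℤ, 7 * z = (Z : ℚ)) ∧ (∃ W : ℤ, 7 * w = (W : ℚ)) ∧
      ∃ r : ℕ, x + 3 * y + 5 * z = (l : ℚ) * (r : ℚ) ^ m := by
  obtain ⟨r, x, y, z, w, h1, h2⟩ := exists_hasRep hl hm n
  have h1' : (49 : ℚ) * n = x ^ 2 + y ^ 2 + z ^ 2 + w ^ 2 := by exact_mod_cast h1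
  have h2' : (x : ℚ) + 3 * y + 5 * z = 7 * (l * r ^ m) := by exact_mod_cast h2
  exact ⟨x / 7, y / 7, z / 7, w / 7, by linarith, ⟨x, by ring⟩, ⟨y, by ring⟩, ⟨z, by ring⟩,
    ⟨w, by ring⟩, r, by linarith⟩
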